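/- Let $V$ be a vertex algebra over a field of characteristic $0$. Then the two formulations of associativity are equivalent: $V$ satisfies the associator formula $(a\,{}_z\, b)\,{}_y\, c - a\,{}_{z+y}\,(b\,{}_y\, c) = b\,{}_y\,(a\,{}_{y+z}\, c - a\,{}_{z+y}\, c)$ for all $a,b,c \in V$ (where $V$ satisfies all other vertex algebra axioms) if and only if for all $a,b,c \in V$ there exists $l \in \mathbb{N}$ with $(z+w)^l\,(a\,{}_z\, b)\,{}_w\, c = (z+w)^l\, a\,{}_{z+w}\,(b\,{}_w\, c)$. -/

import Mathlib

/- Coefficient-wise formalization of vertex algebras: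
a series `w ∈ V((z))` is encoded by its coefficient function `ℤ → V`
(the value at `n` being the coefficient of `z^n`), and a field/product
`a ⊗ b ↦ a_z b ∈ V((z))` by a map `V → V → ℤ → V`. -/

namespace VertexCohomology

open scoped BigOperators

section Defs

variable (𝕜 : Type*) [Field 𝕜] [CharZero 𝕜]
variable {V W M : Type*} [AddCommGroup V] [Module 𝕜 V] [AddCommGroup M] [Module 𝕜 M]

/-- Coefficient of `z^n` in `e^{z d} w(z)`, where `w` is a series with coefficients `w n`. -/
noncomputable def ezd (d : M →ₗ[𝕜] M) (w : ℤ → M) : ℤ → M :=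
  fun n => ∑ᶠ k : ℕ, ((k.factorial : 𝕜)⁻¹) • (d ^ k) (w (n - (k : ℤ)))

/-- Coefficient of `z^n` in `w(-z)`. -/
def negz (w : ℤ → M) : ℤ → M := fun n => ((n.negOnePow : ℤ)) • w n

/-- Coefficient of `z^n` in `(d/dz) w(z)`. -/
def derivz (w : ℤ → M) : ℤ → M := fun n => (n + 1) • w (n + 1)

/-- The constant series with value `a`. -/
def unitSeries (a : M) : ℤ → M := fun n => if n = 0 then a else 0

/-- Coefficient of `z^m w^n` in `(z+w)^l · F(z,w)`, where `F m n` is the coefficient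
of `z^m w^n` of a formal series in two variables. -/
def mulZW (l : ℕ) (F : ℤ → ℤ → M) : ℤ → ℤ → M :=
  fun m n => ∑ k ∈ Finset.range (l + 1), (l.choose k : ℤ) • F (m - ((l - k : ℕ) : ℤ)) (n - (k : ℤ))

/-- Coefficient of `x^m y^n` in `(x-y)^l · F(x,y)`. -/
def mulZmW (l : ℕ) (F : ℤ → ℤ → M) : ℤ → ℤ → M :=
  fun m n => ∑ k ∈ Finset.range (l + 1),
    ((-1 : ℤ) ^ k * (l.choose k : ℤ)) • F (m - ((l - k : ℕ) : ℤ)) (n - (k : ℤ))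

/-- Coefficient of `z^m w^n` in `F(a, ·)_{z+w}` applied to the series `u` in the
variable `w`; here `(z+w)^j` is expanded in nonnegative powers of `w`:
`(z+w)^j = ∑_{i ≥ 0} C(j,i) z^{j-i} w^i`. -/
noncomputable def shiftComp (F : V → W → ℤ → M) (a : V) (u : ℤ → W) : ℤ → ℤ → M :=
  fun m n => ∑ᶠ i : ℕ, (Ring.choose (m + (i : ℤ)) i) • F a (u (n - (i : ℤ))) (m + (i : ℤ))

/-- The axioms of a vertex algebra, stated coefficient-wise:
`Y a b n` is the coefficient of `z^n` in `a_z b`. -/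
structure IsVertexAlg (Y : V → V → ℤ → V) (one : V) (D : V →ₗ[𝕜] V) : Prop where
  linear_left : ∀ (b : V) (n : ℤ), IsLinearMap 𝕜 (fun a => Y a b n)
  linear_right : ∀ (a : V) (n : ℤ), IsLinearMap 𝕜 (fun b => Y a b n)
  trunc : ∀ a b, ∃ N : ℤ, ∀ n < N, Y a b n = 0
  unit_left : ∀ a, Y one a = unitSeries a
  unit_right : ∀ a, Y a one = ezd 𝕜 D (unitSeries a)
  transl : ∀ a b, Y (D a) b = derivz (Y a b)
  derivation : ∀ a b n, D (Y a b n) = Y (D a) b n + Y a (D b) n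
  comm : ∀ a b, Y a b = ezd 𝕜 D (negz (Y b a))
  assoc : ∀ a b c, ∃ l : ℕ,
    mulZW l (fun m n => Y (Y a b m) c n) = mulZW l (shiftComp Y a (Y b c))

/-- The axioms of a module over a vertex algebra, stated coefficient-wise. -/
structure IsVModule (Y : V → V → ℤ → V) (one : V) (D : V →ₗ[𝕜] V)
    (YM : V → M → ℤ → M) (d : M →ₗ[𝕜] M) : Prop where
  linear_left : ∀ (u : M) (n : ℤ), IsLinearMap 𝕜 (fun a => YM a u n)
  linear_right : ∀ (a : V) (n : ℤ), IsLinearMap 𝕜 (fun u => YM a u n)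
  trunc : ∀ a u, ∃ N : ℤ, ∀ n < N, YM a u n = 0
  unit : ∀ u, YM one u = unitSeries u
  transl : ∀ a u, YM (D a) u = derivz (YM a u)
  derivation : ∀ a u n, d (YM a u n) = YM (D a) u n + YM a (d u) n
  assoc : ∀ a b u, ∃ l : ℕ,
    mulZW l (fun m n => YM (Y a b m) u n) = mulZW l (shiftComp YM a (YM b u))

/-- The right action `u_z a := e^{z d}(a_{-z} u)` of `V` on `M`. -/
noncomputable def rAct (YM : V → M → ℤ → M) (d : M →ₗ[𝕜] M) (u : M) (a : V) : ℤ → M :=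
  ezd 𝕜 d (negz (YM a u))

/-- `(δ₁ g)_z (a,b) = a_z g(b) - g(a_z b) + g(a)_z b`. -/
noncomputable def delta1 (Y : V → V → ℤ → V) (YM : V → M → ℤ → M) (d : M →ₗ[𝕜] M)
    (g : V → M) (a b : V) : ℤ → M :=
  fun n => YM a (g b) n - g (Y a b n) + rAct 𝕜 YM d (g a) b n

/-- Membership in `C²(V,M)`. -/
structure IsC2 (one : V) (D : V →ₗ[𝕜] V) (d : M →ₗ[𝕜] M) (f : V → V → ℤ → M) : Prop where
  linear_left : ∀ (b : V) (n : ℤ), IsLinearMap 𝕜 (fun a => f a b n)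
  linear_right : ∀ (a : V) (n : ℤ), IsLinearMap 𝕜 (fun b => f a b n)
  trunc : ∀ a b, ∃ N : ℤ, ∀ n < N, f a b n = 0
  unit_right : ∀ a, f a one = 0
  unit_left : ∀ b, f one b = 0
  transl : ∀ a b, derivz (f a b) = f (D a) b
  derivation : ∀ a b n, d (f a b n) = f (D a) b n + f a (D b) n
  symm : ∀ a b, f a b = ezd 𝕜 d (negz (f b a))

/-- The 2-cocycle condition: for all `a,b,c` there is `N` with
`(x+z)^N [f_z(a_x b, c) + f_x(a,b)_z c] = (x+z)^N [a_{x+z} f_z(b,c) + f_{x+z}(a, b_z c)]`,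
coefficients taken at `x^m z^n`, `(x+z)^j` expanded in nonnegative powers of `z`. -/
def Cocycle (Y : V → V → ℤ → V) (YM : V → M → ℤ → M) (d : M →ₗ[𝕜] M)
    (f : V → V → ℤ → M) : Prop :=
  ∀ a b c : V, ∃ N : ℕ,
    mulZW N (fun m n => f (Y a b m) c n + rAct 𝕜 YM d (f a b m) c n)
      = mulZW N (fun m n => shiftComp YM a (f b c) m n + shiftComp f a (Y b c) m n)

/-- The square-zero extension product on `V ⊕ M`:
`(a,u)_z (b,v) = (a_z b, a_z v + u_z b + ψ_z(a,b))`. -/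
noncomputable def extY (Y : V → V → ℤ → V) (YM : V → M → ℤ → M) (d : M →ₗ[𝕜] M)
    (ψ : V → V → ℤ → M) : V × M → V × M → ℤ → V × M :=
  fun p q n => (Y p.1 q.1 n, YM p.1 q.2 n + rAct 𝕜 YM d p.2 q.1 n + ψ p.1 q.1 n)

/-- The first-order deformed product on `V[t]/(t²) ≃ V × V` (first component the
constant term, second the coefficient of `t`): `a_z^t b = a_z b + t f_z(a,b)`. -/
def defY (Y : V → V → ℤ → V) (f : V → V → ℤ → V) : V × V → V × V → ℤ → V × V :=
  fun p q n => (Y p.1 q.1 n, Y p.1 q.2 n + Y p.2 q.1 n + f p.1 q.1 n)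

end Defs

section Aux

/-- Binomial coefficient with an integer lower index (zero when it is negative). -/
noncomputable def ch (x i : ℤ) : ℤ := if 0 ≤ i then Ring.choose x i.toNat else 0

lemma ch_nat (x : ℤ) (i : ℕ) : ch x i = Ring.choose x i := by simp [ch]

lemma ch_neg (x i : ℤ) (h : i < 0) : ch x i = 0 := by simp [ch, h]

lemma ch_zero (x : ℤ) : ch x 0 = 1 := by simp [ch]

lemma ch_pascal (x i : ℤ) : ch (x + 1) i = ch x i + ch x (i - 1) := by
  rcases lt_trichotomy i 0 with h | h | h
  · rw [ch_neg _ _ h, ch_neg _ _ h, ch_neg _ _ (by omega)]; rfl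
  · subst h; rw [ch_zero, ch_zero, ch_neg _ _ (by omega)]; rfl
  · obtain ⟨k, rfl⟩ : ∃ k : ℕ, i = ((k + 1 : ℕ) : ℤ) := ⟨(i - 1).toNat, by omega⟩
    rw [show (((k + 1 : ℕ) : ℤ) - 1) = (k : ℤ) by push_cast; ring, ch_nat, ch_nat, ch_nat,
      Ring.choose_succ_succ, add_comm]

lemma ch_natCast (n k : ℕ) : ch n k = (n.choose k : ℤ) := by
  rw [ch_nat, Ring.choose_natCast]

lemma ch_lt (x i : ℤ) (hx : 0 ≤ x) (h : x < i) : ch x i = 0 := by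
  lift x to ℕ using hx
  lift i to ℕ using (by omega)
  rw [ch_natCast, Nat.choose_eq_zero_of_lt (by omega)]; rfl

lemma ch_symm (x i : ℤ) (hx : 0 ≤ x) : ch x (x - i) = ch x i := by
  rcases lt_or_ge i 0 with h | h
  · rw [ch_neg x i h, ch_lt _ _ hx (by omega)]
  rcases lt_or_ge x i with h' | h'
  · rw [ch_lt x i hx h', ch_neg _ _ (by omega)]
  lift x to ℕ using hx
  lift i to ℕ using h
  rw [← Nat.cast_sub (by omega), ch_natCast, ch_natCast, Nat.choose_symm (by omega)]

/-- Sign `(-1)^n`. -/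
def sg (n : ℤ) : ℤ := (n.negOnePow : ℤ)

lemma sg_add (m n : ℤ) : sg (m + n) = sg m * sg n := by
  simp [sg, Int.negOnePow_add]

lemma sg_one : sg 1 = -1 := by simp [sg]

lemma sg_succ (n : ℤ) : sg (n + 1) = - sg n := by rw [sg_add, sg_one]; ring

lemma sg_pred (n : ℤ) : sg (n - 1) = - sg n := by
  have := sg_succ (n - 1); rw [sub_add_cancel] at this; omega

lemma sg_sq (n : ℤ) : sg n * sg n = 1 := by
  rw [← sg_add]; simp [sg, Int.negOnePow_even _ (Even.add_self n)]

lemma ch_negate (x k : ℤ) : ch (x + k) k = sg k * ch (-x - 1) k := by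
  rcases lt_or_ge k 0 with h | h
  · simp [ch_neg _ _ h]
  lift k to ℕ using h
  have h := Ring.choose_neg (x + 1) k
  rw [ch_nat, ch_nat, show -x - 1 = -(x + 1) by ring, h,
    show x + 1 + (k : ℤ) - 1 = x + k by ring]
  rw [Units.smul_def, smul_eq_mul, ← mul_assoc]
  have := sg_sq k
  unfold sg at *
  rw [this, one_mul]

lemma ch_vander (m n s : ℤ) :
    ∑ k ∈ Finset.Icc 0 m, ch (n + k) k * (sg (m - k) * ch s (m - k)) = ch (m + n - s) m := by
  rcases lt_or_ge m 0 with h | h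
  · rw [ch_neg _ _ h, Finset.Icc_eq_empty (by omega)]; rfl
  lift m to ℕ using h
  have h1 : ch (m + n - s) m = sg m * ch (-n - 1 + s) m := by
    rw [show (m : ℤ) + n - s = (n - s) + m by ring, ch_negate]; congr 2; ring
  rw [h1, ch_nat, Ring.add_choose_eq _ (Commute.all _ _), Finset.mul_sum,
    Finset.Nat.sum_antidiagonal_eq_sum_range_succ
      (fun i j => sg m * (Ring.choose (-n - 1) i * Ring.choose s j))]
  symm
  refine Finset.sum_bij (fun (k : ℕ) _ => (k : ℤ)) ?_ ?_ ?_ ?_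
  · intro k hk; simp at hk ⊢; omega
  · intro a _ b _ h; exact_mod_cast h
  · intro b hb; simp at hb; exact ⟨b.toNat, by simp; omega, by omega⟩
  · intro k hk
    simp at hk
    rw [ch_negate, ← Nat.cast_sub (by omega), ch_nat, ch_nat,
      show (m : ℤ) = k + (m - k : ℕ) by omega, sg_add]
    ring

variable {V : Type*} [AddCommGroup V]

/-- Multiplication by the first variable. -/
def SX (V : Type*) [AddCommGroup V] : Module.End ℤ (ℤ → ℤ → V) where
  toFun F := fun m n => F (m - 1) n
  map_add' _ _ := rfl
  map_smul' _ _ := rfl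

/-- Multiplication by the second variable. -/
def SY (V : Type*) [AddCommGroup V] : Module.End ℤ (ℤ → ℤ → V) where
  toFun F := fun m n => F m (n - 1)
  map_add' _ _ := rfl
  map_smul' _ _ := rfl

/-- Swap of variables. -/
def th (V : Type*) [AddCommGroup V] : Module.End ℤ (ℤ → ℤ → V) where
  toFun F := fun m n => F n m
  map_add' _ _ := rfl
  map_smul' _ _ := rfl

/-- Signed swap of variables. -/
def kp (V : Type*) [AddCommGroup V] : Module.End ℤ (ℤ → ℤ → V) where
  toFun F := fun m n => sg n • F n m
  map_add' _ _ := by ext; simp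
  map_smul' _ _ := by ext; simp only [Pi.smul_apply, RingHom.id_apply]; rw [smul_comm]

lemma SX_apply (F : ℤ → ℤ → V) (m n : ℤ) : (SX V) F m n = F (m - 1) n := rfl
lemma SY_apply (F : ℤ → ℤ → V) (m n : ℤ) : (SY V) F m n = F m (n - 1) := rfl
lemma th_apply (F : ℤ → ℤ → V) (m n : ℤ) : (th V) F m n = F n m := rfl
lemma kp_apply (F : ℤ → ℤ → V) (m n : ℤ) : (kp V) F m n = sg n • F n m := rfl

lemma comm_XY : Commute ((SX V) : Module.End ℤ (ℤ → ℤ → V)) (SY V) := rfl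

lemma SX_pow (k : ℕ) (F : ℤ → ℤ → V) (m n : ℤ) : ((SX V) ^ k) F m n = F (m - k) n := by
  induction k generalizing m with
  | zero => simp
  | succ k ih => rw [pow_succ', Module.End.mul_apply, SX_apply, ih]; congr 1; push_cast; ring

lemma SY_pow (k : ℕ) (F : ℤ → ℤ → V) (m n : ℤ) : ((SY V) ^ k) F m n = F m (n - k) := by
  induction k generalizing n with
  | zero => simp
  | succ k ih => rw [pow_succ', Module.End.mul_apply, SY_apply, ih]; congr 1; push_cast; ring

lemma mulZW_eq (l : ℕ) (F : ℤ → ℤ → V) : mulZW l F = (((SX V) + (SY V)) ^ l) F := by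
  ext m n
  rw [add_comm (SX V) (SY V), comm_XY.symm.add_pow, LinearMap.sum_apply, Finset.sum_apply, Finset.sum_apply]
  unfold mulZW
  refine Finset.sum_congr rfl fun k hk => ?_
  rw [← Nat.cast_comm, ← nsmul_eq_mul]
  simp only [LinearMap.smul_apply, Pi.smul_apply, Module.End.mul_apply, SY_pow, SX_pow,
    Nat.cast_smul_eq_nsmul]

/-- Transport of powers through a map. -/
lemma pow_transport {E : Type*} [AddCommGroup E] (T T' : Module.End ℤ E) (f : E → E)
    (Pr : E → Prop) (hP : ∀ x, Pr x → Pr (T x)) (h : ∀ x, Pr x → f (T x) = T' (f x))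
    (k : ℕ) (x : E) (hx : Pr x) : Pr ((T ^ k) x) ∧ f ((T ^ k) x) = (T' ^ k) (f x) := by
  induction k with
  | zero => simpa using hx
  | succ k ih =>
    rw [pow_succ', pow_succ', Module.End.mul_apply, Module.End.mul_apply]
    exact ⟨hP _ ih.1, by rw [h _ ih.1, ih.2]⟩

/-- Boundedness below in the second variable. -/
def yb (F : ℤ → ℤ → V) : Prop := ∃ K : ℤ, ∀ m n, n < K → F m n = 0

lemma yb_SX (F : ℤ → ℤ → V) (h : yb F) : yb ((SX V) F) := by
  obtain ⟨K, h⟩ := h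
  exact ⟨K, fun m n hn => h _ _ hn⟩

lemma yb_SY (F : ℤ → ℤ → V) (h : yb F) : yb ((SY V) F) := by
  obtain ⟨K, h⟩ := h
  exact ⟨K, fun m n hn => h _ _ (by omega)⟩

lemma yb_sub (F G : ℤ → ℤ → V) (h : yb F) (h' : yb G) : yb (F - G) := by
  obtain ⟨K, h⟩ := h
  obtain ⟨K', h'⟩ := h'
  refine ⟨min K K', fun m n hn => ?_⟩
  simp [h m n (by omega), h' m n (by omega)]

/-- Kernel transform. -/
noncomputable def kk (c : ℤ → ℤ → ℤ) (F : ℤ → ℤ → V) : ℤ → ℤ → V :=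
  fun m n => ∑ᶠ s : ℤ, c s m • F s (m + n - s)

lemma kk_SX (c : ℤ → ℤ → ℤ) (hc : ∀ s m, c (s + 1) m = c s m + c s (m - 1)) (F : ℤ → ℤ → V)
    (m n : ℤ) (h1 : (Function.support fun s => c s m • F s (m + (n - 1) - s)).Finite)
    (h2 : (Function.support fun s => c s (m - 1) • F s (m - 1 + n - s)).Finite) :
    kk c ((SX V) F) m n = kk c F (m - 1) n + kk c F m (n - 1) := by
  unfold kk
  rw [add_comm (∑ᶠ s : ℤ, _), ← finsum_add_distrib h1 h2, ← finsum_comp_equiv (Equiv.addRight (1 : ℤ))]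
  refine finsum_congr fun s => ?_
  simp only [Equiv.coe_addRight, SX_apply, hc, add_smul]
  congr 3 <;> ring

/-- The kernel of the substitution `x = z + y`. -/
noncomputable def cs (s m : ℤ) : ℤ := ch s (s - m)

lemma cs_rec (s m : ℤ) : cs (s + 1) m = cs s m + cs s (m - 1) := by
  unfold cs
  rw [ch_pascal, add_comm]; congr 2 <;> ring

lemma cs_lt (s m : ℤ) (h : s < m) : cs s m = 0 := ch_neg _ _ (by omega)

lemma cs_self (m : ℤ) : cs m m = 1 := by simp [cs, ch_zero]

lemma cs_nonneg (s m : ℤ) (h : m < 0) (hs : 0 ≤ s) : cs s m = 0 := ch_lt _ _ hs (by omega)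

lemma fin_of_neg (F : ℤ → ℤ → V) (m n : ℤ) (hm : m < 0) :
    (Function.support fun s => cs s m • F s n).Finite := by
  refine (Set.finite_Icc m 0).subset fun s hs => ?_
  by_contra h
  apply hs
  simp only [Set.mem_Icc, not_and_or, not_le] at h
  rcases h with h | h
  · simp [cs_lt s m h]
  · simp [cs_nonneg s m hm h.le]

lemma fin_of_neg' (F : ℤ → ℤ → V) (m n : ℤ) (hm : m < 0) :
    (Function.support fun s => cs s m • F s (n - s)).Finite :=
  fin_of_neg (fun s _ => F s (n - s)) m n hm

lemma fin_of_yb (F : ℤ → ℤ → V) (m n : ℤ) (hF : yb F) :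
    (Function.support fun s => cs s m • F s (n - s)).Finite := by
  obtain ⟨K, hK⟩ := hF
  refine (Set.finite_Icc m (n - K)).subset fun s hs => ?_
  by_contra h
  apply hs
  simp only [Set.mem_Icc, not_and_or, not_le] at h
  rcases h with h | h
  · simp [cs_lt s m h]
  · simp [hK s (n - s) (by omega)]

/-- The substitution `x = z + y`. -/
noncomputable def sig (F : ℤ → ℤ → V) : ℤ → ℤ → V := kk cs F

lemma sig_SX (F : ℤ → ℤ → V) (h : yb F) : sig ((SX V) F) = ((SX V) + (SY V)) (sig F) := by
  ext m n
  exact kk_SX cs cs_rec F m n (fin_of_yb F _ _ h) (fin_of_yb F _ _ h)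

lemma sig_SY' (F : ℤ → ℤ → V) (m n : ℤ) : sig ((SY V) F) m n = sig F m (n - 1) := by
  refine finsum_congr fun s => ?_
  rw [SY_apply]; congr 2; ring

lemma sig_SY (F : ℤ → ℤ → V) : sig ((SY V) F) = (SY V) (sig F) := by
  ext m n
  exact sig_SY' F m n

lemma sig_sub (F G : ℤ → ℤ → V) (hF : yb F) (hG : yb G) : sig (F - G) = sig F - sig G := by
  ext m n
  refine Eq.trans (finsum_congr fun s => ?_)
    (finsum_sub_distrib (fin_of_yb F m (m + n) hF) (fin_of_yb G m (m + n) hG))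
  simp [smul_sub]

lemma sig_sub_neg (F G : ℤ → ℤ → V) (m n : ℤ) (hm : m < 0) :
    sig (F - G) m n = sig F m n - sig G m n := by
  refine Eq.trans (finsum_congr fun s => ?_)
    (finsum_sub_distrib (fin_of_neg' F m (m + n) hm) (fin_of_neg' G m (m + n) hm))
  simp [smul_sub]

lemma sig_Mn (F : ℤ → ℤ → V) (h : yb F) : sig (((SX V) - (SY V)) F) = (SX V) (sig F) := by
  rw [LinearMap.sub_apply, sig_sub _ _ (yb_SX F h) (yb_SY F h), sig_SX F h, sig_SY]
  simp

lemma sig_Mm (F : ℤ → ℤ → V) (h : yb F) : sig (((SY V) - (SX V)) F) = (-(SX V)) (sig F) := by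
  rw [LinearMap.sub_apply, sig_sub _ _ (yb_SY F h) (yb_SX F h), sig_SX F h, sig_SY]
  simp

lemma sig_Mn_row (F : ℤ → ℤ → V) (N : ℕ) (m n : ℤ) (hm : m < 0) :
    sig ((((SX V) - (SY V)) ^ N) F) m n = sig F (m - N) n := by
  induction N generalizing m n with
  | zero => simp
  | succ N ih =>
    rw [pow_succ', Module.End.mul_apply, LinearMap.sub_apply, sig_sub_neg _ _ _ _ hm, sig_SY']
    have := kk_SX cs cs_rec ((((SX V) - (SY V)) ^ N) F) m n (fin_of_neg' _ _ _ hm)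
      (fin_of_neg' _ _ _ (by omega))
    change sig _ m n = sig _ _ _ + sig _ _ _ at this
    rw [this, add_sub_cancel_right, ih _ _ (by omega)]
    congr 1; push_cast; ring

/-- Triangularity of `sig`. -/
lemma sig_tri (F : ℤ → ℤ → V) (hF : yb F) (S : ℤ → Prop)
    (hS : ∀ m s, S m → m < s → S s ∨ cs s m = 0)
    (h0 : ∀ m n, S m → sig F m n = 0) (m n : ℤ) (hm : S m) : F m n = 0 := by
  obtain ⟨K, hK⟩ := hF
  have key : ∀ (d : ℕ) (n m : ℤ), n < K + d → S m → F m n = 0 := by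
    intro d
    induction d with
    | zero => intro n m hn _; exact hK _ _ (by simpa using hn)
    | succ d ih =>
      intro n m hn hm
      have h := h0 m n hm
      unfold sig kk at h
      rw [finsum_eq_single _ m] at h
      · simpa [cs_self] using h
      · intro s hs
        rcases lt_or_gt_of_ne hs with h' | h'
        · simp [cs_lt s m h']
        · rcases hS m s hm h' with h2 | h2
          · rw [ih _ s _ h2, smul_zero]
            push_cast at hn; omega
          · simp [h2]
  exact key ((n - K).toNat + 1) n m (by omega) hm

/-- Support in the first quadrant. -/
def nn (F : ℤ → ℤ → V) : Prop := ∀ m n, (m < 0 ∨ n < 0) → F m n = 0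

lemma sig_nn (F : ℤ → ℤ → V) (hF : nn F) (m n : ℤ) :
    sig F m n = ∑ s ∈ Finset.Icc 0 (m + n), ch s m • F s (m + n - s) := by
  unfold sig kk
  rw [finsum_eq_sum_of_support_subset (s := Finset.Icc 0 (m + n))]
  · refine Finset.sum_congr rfl fun s hs => ?_
    simp at hs
    rw [cs, ch_symm _ _ hs.1]
  · intro s hs
    by_contra h
    apply hs
    simp at h
    show _ • _ = _
    rw [hF, smul_zero]
    omega

lemma sig_th (F : ℤ → ℤ → V) (hF : nn F) : sig ((th V) F) = (th V) (sig ((kp V) (sig F))) := by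
  ext m n
  have hR : (th V) (sig ((kp V) (sig F))) m n = ∑ k ∈ Finset.Icc 0 m, ch (n + k) k •
      (sg (m - k) • sig F (m - k) (n + k)) := by
    rw [th_apply]
    unfold sig
    rw [kk, ← finsum_comp_equiv (Equiv.addLeft n),
      finsum_eq_sum_of_support_subset (s := Finset.Icc 0 m)]
    · refine Finset.sum_congr rfl fun k hk => ?_
      simp only [Equiv.coe_addLeft, kp_apply, cs]
      rw [show n + k - n = k by ring, show n + m - (n + k) = m - k by ring]
    · intro k hk
      by_contra h
      apply hk
      simp only [Finset.coe_Icc, Set.mem_Icc, not_and_or, not_le] at h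
      simp only [Equiv.coe_addLeft, kp_apply]
      rcases h with h | h
      · rw [cs_lt _ _ (by omega), zero_smul]
      · change _ • _ • sig F _ _ = 0
        rw [sig_nn F hF, Finset.sum_eq_zero, smul_zero, smul_zero]
        intro s _
        rw [ch_neg _ _ (by omega), zero_smul]
  have hL : sig ((th V) F) m n = ∑ s ∈ Finset.Icc 0 (m + n), ch (m + n - s) m • F s (m + n - s) := by
    rw [sig_nn (th V F) (fun m n h => hF n m h.symm)]
    refine Finset.sum_bij (fun s _ => m + n - s) ?_ ?_ ?_ ?_
    · intro s hs; simp at hs ⊢; omega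
    · intro a _ b _ h; simp at h; exact h
    · intro b hb; simp at hb; exact ⟨m + n - b, by simp; omega, by ring⟩
    · intro s hs; rw [th_apply]; congr 2 <;> ring
  rw [hR, hL]
  simp_rw [sig_nn F hF, Finset.smul_sum, smul_smul]
  have e : ∀ k : ℤ, m - k + (n + k) = m + n := fun k => by ring
  simp_rw [e]
  rw [Finset.sum_comm]
  refine Finset.sum_congr rfl fun s _ => ?_
  rw [← Finset.sum_smul, ← ch_vander]

lemma add_inj_zb (F : ℤ → ℤ → V) (M : ℤ) (hM : ∀ m n, m < M → F m n = 0) (l : ℕ)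
    (h : (((SX V) + (SY V)) ^ l) F = 0) : F = 0 := by
  induction l generalizing F with
  | zero => simpa using h
  | succ l ih =>
    rw [pow_succ, Module.End.mul_apply] at h
    have h1 := ih (((SX V) + (SY V)) F) (by
      intro m n hm
      simp [SX_apply, SY_apply, hM m (n - 1) hm, hM (m - 1) n (by omega)]) h
    have key : ∀ (d : ℕ) (m n : ℤ), m < M + d → F m n = 0 := by
      intro d
      induction d with
      | zero => intro m n hm; exact hM _ _ (by simpa using hm)
      | succ d ihd =>
        intro m n hm
        have h2 := congrFun (congrFun h1 m) (n + 1)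
        simp only [LinearMap.add_apply, Pi.add_apply, SX_apply, SY_apply, Pi.zero_apply] at h2
        rw [ihd (m - 1) _ (by push_cast at hm; omega)] at h2
        simpa using h2
    ext m n
    exact key ((m - M).toNat + 1) m n (by omega)

/-- The kernel of the difference of two expansions. -/
noncomputable def ce (j m : ℤ) : ℤ := ch j m - cs j m

lemma ce_rec (s m : ℤ) : ce (s + 1) m = ce s m + ce s (m - 1) := by
  unfold ce; rw [cs_rec, ch_pascal]; ring

lemma ce_nonneg (s m : ℤ) (hs : 0 ≤ s) : ce s m = 0 := by
  unfold ce cs; rw [ch_symm _ _ hs, sub_self]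

lemma fin_ce (F : ℤ → ℤ → V) (m n L : ℤ) (hF : ∀ m n, m < L → F m n = 0) :
    (Function.support fun s => ce s m • F s (n - s)).Finite := by
  refine (Set.finite_Icc L 0).subset fun s hs => ?_
  by_contra h
  apply hs
  simp only [Set.mem_Icc, not_and_or, not_le] at h
  rcases h with h | h
  · simp [hF _ _ h]
  · simp [ce_nonneg s m h.le]

lemma kk_ce_pow (F : ℤ → ℤ → V) (L : ℤ) (hF : ∀ m n, m < L → F m n = 0) (l : ℕ)
    (hl : 0 ≤ L + l) : (((SX V) + (SY V)) ^ l) (kk ce F) = 0 := by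
  have h := pow_transport (SX V) ((SX V) + (SY V)) (kk ce) (fun F => ∃ L, ∀ m n, m < L → F m n = 0)
    (fun F ⟨L, h⟩ => ⟨L, fun m n hm => h _ _ (by omega)⟩)
    (fun F ⟨L, h⟩ => by
      ext m n
      exact kk_SX ce ce_rec F m n (fin_ce F _ _ L h) (fin_ce F _ _ L h)) l F ⟨L, hF⟩
  rw [← h.2]
  ext m n
  unfold kk
  refine Eq.trans (finsum_congr fun s => ?_) finsum_zero
  rcases lt_or_ge s 0 with h | h
  · rw [SX_pow, hF _ _ (by omega), smul_zero]
  · rw [ce_nonneg _ _ h, zero_smul]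

lemma kk_ce_neg (F : ℤ → ℤ → V) (m n : ℤ) (hm : m < 0) : kk ce F m n = - sig F m n := by
  unfold sig kk
  rw [← finsum_neg_distrib]
  refine finsum_congr fun s => ?_
  rw [ce, ch_neg _ _ hm, zero_sub, neg_smul]

lemma kp_transport (T T' : Module.End ℤ (ℤ → ℤ → V)) (f : Module.End ℤ (ℤ → ℤ → V))
    (h : ∀ F, f (T F) = T' (f F)) (k : ℕ) (F : ℤ → ℤ → V) :
    f ((T ^ k) F) = (T' ^ k) (f F) :=
  (pow_transport T T' f (fun _ => True) (fun _ _ => trivial) (fun F _ => h F) k F trivial).2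

/-- Locality from associativity and skew symmetry, at the level of formal series. -/
lemma locality (U W A B : ℤ → ℤ → V) (hU : yb U) (hW : yb W) (M : ℤ)
    (hB : ∀ m n, m < M → B m n = 0)
    (hAB : A = (th V) (sig ((kp V) B))) (l₁ l₂ : ℕ)
    (h1 : (((SX V) + (SY V)) ^ l₁) A = (((SX V) + (SY V)) ^ l₁) (sig U))
    (h2 : (((SX V) + (SY V)) ^ l₂) B = (((SX V) + (SY V)) ^ l₂) (sig W)) :
    ∃ N : ℕ, (((SX V) - (SY V)) ^ N) (U - (th V) W) = 0 := by
  obtain ⟨K, hK⟩ := hW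
  have hW : yb W := ⟨K, hK⟩
  set l := l₁ + l₂ + (-K).toNat with hl
  set N := (-M).toNat with hN
  refine ⟨N, ?_⟩
  have h1' : (((SX V) + (SY V)) ^ l) A = (((SX V) + (SY V)) ^ l) (sig U) := by
    rw [hl, show l₁ + l₂ + (-K).toNat = (l₂ + (-K).toNat) + l₁ by ring, pow_add,
      Module.End.mul_apply, h1]; rfl
  have h2' : (((SX V) + (SY V)) ^ l) B = (((SX V) + (SY V)) ^ l) (sig W) := by
    rw [hl, show l₁ + l₂ + (-K).toNat = (l₁ + (-K).toNat) + l₂ by ring, pow_add,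
      Module.End.mul_apply, h2]; rfl
  have yM : ∀ F : ℤ → ℤ → V, yb F → yb (((SX V) - (SY V)) F) := fun F h =>
    yb_sub _ _ (yb_SX F h) (yb_SY F h)
  have yM' : ∀ F : ℤ → ℤ → V, yb F → yb (((SY V) - (SX V)) F) := fun F h =>
    yb_sub _ _ (yb_SY F h) (yb_SX F h)
  have tX := fun (k : ℕ) (F : ℤ → ℤ → V) (h : yb F) =>
    pow_transport (SX V) ((SX V) + (SY V)) sig yb yb_SX sig_SX k F h
  have tY := fun (k : ℕ) (F : ℤ → ℤ → V) (h : yb F) =>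
    pow_transport (SY V) (SY V) sig yb yb_SY (fun F _ => sig_SY F) k F h
  have tM := fun (k : ℕ) (F : ℤ → ℤ → V) (h : yb F) =>
    pow_transport ((SX V) - (SY V)) (SX V) sig yb yM sig_Mn k F h
  have tM' := fun (k : ℕ) (F : ℤ → ℤ → V) (h : yb F) =>
    pow_transport ((SY V) - (SX V)) (-(SX V)) sig yb yM' sig_Mm k F h
  -- the two series to be compared
  set p : ℤ → ℤ → V := ((SY V) ^ l) (((SX V) ^ l) ((((SX V) - (SY V)) ^ N) U)) with hp
  set q : ℤ → ℤ → V := (((SY V) - (SX V)) ^ N) (((SY V) ^ l) (((SX V) ^ l) W)) with hq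
  have hyp : yb p := (tY l _ (tX l _ (tM N _ hU).1).1).1
  have hyq : yb q := (tM' N _ (tY l _ (tX l _ hW).1).1).1
  have cXP : Commute ((SX V) : Module.End ℤ (ℤ → ℤ → V)) ((SX V) + (SY V)) :=
    (Commute.refl _).add_right comm_XY
  have cYP : Commute ((SY V) : Module.End ℤ (ℤ → ℤ → V)) ((SX V) + (SY V)) :=
    comm_XY.symm.add_right (Commute.refl _)
  have sp : sig p = ((SY V) ^ l) (((SX V) ^ N) ((((SX V) + (SY V)) ^ l) A)) := by
    rw [hp, (tY l _ (tX l _ (tM N _ hU).1).1).2, (tX l _ (tM N _ hU).1).2, (tM N _ hU).2, h1']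
    simp only [← Module.End.mul_apply]
    rw [(cXP.pow_pow N l).eq]
  have sq : sig q = ((-(SX V)) ^ N) (((SY V) ^ l) ((((SX V) + (SY V)) ^ l) B)) := by
    rw [hq, (tM' N _ (tY l _ (tX l _ hW).1).1).2, (tY l _ (tX l _ hW).1).2, (tX l _ hW).2, h2']
  have nnq : nn q := by
    have hneg : ∀ m n, m < 0 → q m n = 0 := by
      intro m n hm
      refine sig_tri q hyq (fun m => m < 0) ?_ ?_ m n hm
      · intro m s hm hs
        rcases lt_or_ge s 0 with h | h
        · exact Or.inl h
        · exact Or.inr (cs_nonneg _ _ hm h)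
      · intro m n hm
        rw [sq]
        have hz : ∀ F : ℤ → ℤ → V, (∀ m n, m < M → F m n = 0) →
            (((-(SX V)) ^ N) F) m n = 0 := by
          intro F hF
          rw [neg_pow]
          have : (((SX V) ^ N) F) m n = 0 := by rw [SX_pow]; exact hF _ _ (by omega)
          rcases neg_one_pow_eq_or (Module.End ℤ (ℤ → ℤ → V)) N with h | h <;> rw [h] <;> simp [this]
        apply hz
        intro m n hm
        rw [SY_pow]
        have hPB := pow_transport ((SX V) + (SY V)) ((SX V) + (SY V)) id
          (fun F : ℤ → ℤ → V => ∀ m n, m < M → F m n = 0)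
          (fun F h m n hm => by
            simp [SX_apply, SY_apply, h m (n - 1) hm, h (m - 1) n (by omega)])
          (fun _ _ => rfl) l B hB
        exact hPB.1 _ _ hm
    intro m n h
    rcases h with h | h
    · exact hneg m n h
    · have hPB := pow_transport ((SY V) - (SX V)) ((SY V) - (SX V)) id
          (fun F : ℤ → ℤ → V => ∀ m n, n < 0 → F m n = 0)
          (fun F h m n hm => by
            simp [SX_apply, SY_apply, h (m - 1) n hm, h m (n - 1) (by omega)])
          (fun _ _ => rfl) N (((SY V) ^ l) (((SX V) ^ l) W)) (by
            intro m n hn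
            rw [SY_pow, SX_pow]
            exact hK _ _ (by omega))
      exact hPB.1 m n h
  have ykB : yb ((kp V) B) := ⟨M, fun m n h => by rw [kp_apply, hB _ _ h, smul_zero]⟩
  have k1 := kp_transport (-(SX V)) (SY V) ((kp V) : Module.End ℤ (ℤ → ℤ → V)) (fun F => by
    ext m n; simp [kp_apply, SX_apply, SY_apply, sg_pred])
  have k2 := kp_transport (SY V) (SX V) ((kp V) : Module.End ℤ (ℤ → ℤ → V)) (fun F => by
    ext m n; simp [kp_apply, SX_apply, SY_apply])
  have k3 := kp_transport ((SX V) + (SY V)) ((SX V) - (SY V)) ((kp V) : Module.End ℤ (ℤ → ℤ → V)) (fun F => by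
    ext m n; simp [kp_apply, SX_apply, SY_apply, sg_pred]; abel)
  have t1 := kp_transport (SX V) (SY V) ((th V) : Module.End ℤ (ℤ → ℤ → V)) (fun F => rfl)
  have t2 := kp_transport (SY V) (SX V) ((th V) : Module.End ℤ (ℤ → ℤ → V)) (fun F => rfl)
  have t3 := kp_transport ((SX V) + (SY V)) ((SX V) + (SY V)) ((th V) : Module.End ℤ (ℤ → ℤ → V)) (fun F => by
    ext m n; simp [th_apply, SX_apply, SY_apply, add_comm])
  have t4 := kp_transport ((SY V) - (SX V)) ((SX V) - (SY V)) ((th V) : Module.End ℤ (ℤ → ℤ → V)) (fun F => rfl)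
  have stq : sig ((th V) q) = sig p := by
    rw [sig_th q nnq, sq, k1, k2, k3, (tY N _ (tX l _ (tM l _ ykB).1).1).2,
      (tX l _ (tM l _ ykB).1).2, (tM l _ ykB).2, t2, t3, t1, ← hAB, sp]
    simp only [← Module.End.mul_apply]
    rw [(cYP.symm.pow_pow l l).eq, ← mul_assoc, (comm_XY.pow_pow N l).eq, mul_assoc]
  have ytq : yb ((th V) q) := ⟨0, fun m n h => nnq _ _ (Or.inl h)⟩
  have hpq : p - (th V) q = 0 := by
    ext m n
    refine sig_tri (p - (th V) q) (yb_sub _ _ hyp ytq) (fun _ => True)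
      (fun _ _ _ _ => Or.inl trivial) (fun m n _ => ?_) m n trivial
    rw [sig_sub _ _ hyp ytq, stq, sub_self]; rfl
  have cXM : Commute ((SX V) : Module.End ℤ (ℤ → ℤ → V)) ((SX V) - (SY V)) :=
    (Commute.refl _).sub_right comm_XY
  have cYM : Commute ((SY V) : Module.End ℤ (ℤ → ℤ → V)) ((SX V) - (SY V)) :=
    comm_XY.symm.sub_right (Commute.refl _)
  have htq : (th V) q = ((SY V) ^ l) (((SX V) ^ l) ((((SX V) - (SY V)) ^ N) ((th V) W))) := by
    rw [hq, t4, t2, t1]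
    simp only [← Module.End.mul_apply]
    rw [← mul_assoc (SX V ^ l), (comm_XY.pow_pow l l).eq, mul_assoc, ← mul_assoc,
      (cYM.symm.pow_pow N l).eq, mul_assoc, ← mul_assoc (_ ^ N), (cXM.symm.pow_pow N l).eq,
      mul_assoc]
  rw [htq, hp, ← map_sub, ← map_sub, ← map_sub] at hpq
  ext m n
  have := congrFun (congrFun hpq (m + l)) (n + l)
  rw [SY_pow, SX_pow] at this
  simpa using this

lemma finsum_nat (f : ℤ → V) (h : ∀ i < 0, f i = 0) : ∑ᶠ i : ℤ, f i = ∑ᶠ i : ℕ, f i := by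
  rw [← finsum_mem_range (f := f) (g := fun i : ℕ => (i : ℤ)) Nat.cast_injective]
  refine finsum_congr fun i => ?_
  by_cases hi : i ∈ Set.range (fun i : ℕ => (i : ℤ))
  · simp only [finsum_eq_if, hi, if_true]
  · simp only [finsum_eq_if, hi, if_false]
    apply h
    by_contra h'
    exact hi ⟨i.toNat, by simp; omega⟩

lemma sig_eq_nat (F : ℤ → ℤ → V) (m n : ℤ) :
    sig F m n = ∑ᶠ i : ℕ, Ring.choose (m + (i : ℤ)) i • F (m + i) (n - i) := by
  unfold sig kk
  rw [← finsum_comp_equiv (Equiv.addLeft m), finsum_nat]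
  · refine finsum_congr fun i => ?_
    simp only [Equiv.coe_addLeft, cs]
    rw [show m + (i : ℤ) - m = i by ring, ch_nat, show m + n - (m + (i : ℤ)) = n - i by ring]
  · intro i hi
    simp only [Equiv.coe_addLeft]
    rw [cs_lt _ _ (by omega), zero_smul]

variable {𝕜 : Type*} [Field 𝕜] [CharZero 𝕜] [Module 𝕜 V]

lemma Y_Dpow (Y : V → V → ℤ → V) (D : V →ₗ[𝕜] V) (htl : ∀ a b, Y (D a) b = derivz (Y a b))
    (k : ℕ) (v c : V) (n : ℤ) :
    Y ((D ^ k) v) c n = ((k.factorial : ℤ) * Ring.choose (n + k) k) • Y v c (n + k) := by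
  induction k generalizing v with
  | zero => simp
  | succ k ih =>
    rw [pow_succ, Module.End.mul_apply, ih, htl, derivz, smul_smul]
    have h := Ring.choose_add_smul_choose (n + k : ℤ) k 1
    rw [Nat.cast_one, Ring.choose_one_right, Nat.choose_one_right, nsmul_eq_mul] at h
    rw [show n + ((k + 1 : ℕ) : ℤ) = n + k + 1 by push_cast; ring]
    congr 1
    rw [Nat.factorial_succ]
    push_cast at h ⊢
    linear_combination (-(k.factorial : ℤ)) * h

lemma skew_formal (Y : V → V → ℤ → V) (D : V →ₗ[𝕜] V)
    (hll : ∀ (b : V) (n : ℤ), IsLinearMap 𝕜 (fun a => Y a b n))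
    (htr : ∀ a b, ∃ N : ℤ, ∀ n < N, Y a b n = 0)
    (htl : ∀ a b, Y (D a) b = derivz (Y a b))
    (hcm : ∀ a b, Y a b = ezd 𝕜 D (negz (Y b a))) (a b c : V) :
    (fun m n => Y (Y a b m) c n) = th V (sig (kp V (fun m n => Y (Y b a m) c n))) := by
  ext m n
  rw [th_apply, sig_eq_nat, hcm a b, ezd]
  obtain ⟨N, hN⟩ := htr b a
  set f : V →ₗ[𝕜] V := (hll c n).mk' _ with hf
  have hfa : ∀ v, Y v c n = f v := fun v => rfl
  rw [hfa]
  have := f.toAddMonoidHom.map_finsum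
    (f := fun k : ℕ => ((k.factorial : 𝕜)⁻¹) • (D ^ k) (negz (Y b a) (m - (k : ℤ)))) (by
      refine (Set.finite_Iic (m - N).toNat).subset fun k hk => ?_
      by_contra h
      apply hk
      simp only [Set.mem_Iic, not_le] at h
      simp [negz, hN (m - k) (by omega)])
  refine this.trans (finsum_congr fun k => ?_)
  change f _ = _
  rw [map_smul, negz, map_zsmul, map_zsmul, ← hfa, Y_Dpow Y D htl, kp_apply]
  change _ • sg (m - k) • _ = _
  rw [smul_comm _ (sg (m - k)), smul_comm _ (sg (m - k)), mul_smul]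
  congr 1
  rw [natCast_zsmul, ← Nat.cast_smul_eq_nsmul 𝕜, smul_smul, inv_mul_cancel₀, one_smul]
  exact_mod_cast k.factorial_ne_zero

lemma assoc_rhs (Y : V → V → ℤ → V)
    (hlr : ∀ (a : V) (n : ℤ), IsLinearMap 𝕜 (fun b => Y a b n)) (a b c : V) (m n : ℤ) :
    (∑ᶠ p : ℤ, Y b
        ((if 0 ≤ m then (Ring.choose (m + p) m.toNat) • Y a c (m + p) else 0)
          - (if 0 ≤ p then (Ring.choose (m + p) p.toNat) • Y a c (m + p) else 0))
        (n - p)) = kk ce (th V (fun m n => Y b (Y a c n) m)) m n := by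
  unfold kk
  rw [← finsum_comp_equiv (Equiv.addLeft m) (f := fun s => ce s m • _)]
  refine finsum_congr fun p => ?_
  simp only [Equiv.coe_addLeft, th_apply]
  have h1 : ((if 0 ≤ m then (Ring.choose (m + p) m.toNat) • Y a c (m + p) else 0)
          - (if 0 ≤ p then (Ring.choose (m + p) p.toNat) • Y a c (m + p) else 0))
      = ce (m + p) m • Y a c (m + p) := by
    rw [ce, cs, ch, ch, show m + p - m = p by ring, sub_smul]
    congr 1 <;> split_ifs <;> simp
  rw [h1, show m + n - (m + p) = n - p by ring]
  exact map_zsmul ((hlr b (n - p)).mk' _) _ _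

end Aux


variable (𝕜 : Type*) [Field 𝕜] [CharZero 𝕜]
  {V : Type*} [AddCommGroup V] [Module 𝕜 V]
  (Y : V → V → ℤ → V) (one : V) (D : V →ₗ[𝕜] V)

/-- given all the other vertex algebra axioms, the associator formula
`(a_z b)_y c - a_{z+y}(b_y c) = b_y (a_{y+z} c - a_{z+y} c)` holds iff for all
`a,b,c` there is `l` with `(z+w)^l (a_z b)_w c = (z+w)^l a_{z+w}(b_w c)`. -/
theorem associator_iff_associativity
    (hll : ∀ (b : V) (n : ℤ), IsLinearMap 𝕜 (fun a => Y a b n))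
    (hlr : ∀ (a : V) (n : ℤ), IsLinearMap 𝕜 (fun b => Y a b n))
    (htr : ∀ a b, ∃ N : ℤ, ∀ n < N, Y a b n = 0)
    (hul : ∀ a, Y one a = unitSeries a)
    (hur : ∀ a, Y a one = ezd 𝕜 D (unitSeries a))
    (htl : ∀ a b, Y (D a) b = derivz (Y a b))
    (hdv : ∀ a b n, D (Y a b n) = Y (D a) b n + Y a (D b) n)
    (hcm : ∀ a b, Y a b = ezd 𝕜 D (negz (Y b a))) :
    (∀ (a b c : V) (m n : ℤ),
        Y (Y a b m) c n - shiftComp Y a (Y b c) m n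
          = ∑ᶠ p : ℤ, Y b
              ((if 0 ≤ m then (Ring.choose (m + p) m.toNat) • Y a c (m + p) else 0)
                - (if 0 ≤ p then (Ring.choose (m + p) p.toNat) • Y a c (m + p) else 0))
              (n - p))
      ↔ (∀ a b c : V, ∃ l : ℕ,
          mulZW l (fun m n => Y (Y a b m) c n) = mulZW l (shiftComp Y a (Y b c))) := by
  have hsh : ∀ a b c : V, shiftComp Y a (Y b c) = sig (fun m n => Y a (Y b c n) m) := by
    intro a b c
    ext m n
    rw [sig_eq_nat]; rfl
  have hz : ∀ b n, Y 0 b n = 0 := fun b n => (hll b n).map_zero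
  have hz' : ∀ a n, Y a 0 n = 0 := fun a n => (hlr a n).map_zero
  have hyb : ∀ a b c : V, yb (fun m n => Y a (Y b c n) m) := by
    intro a b c
    obtain ⟨K, hK⟩ := htr b c
    exact ⟨K, fun m n hn => by simp only [hK n hn, hz']⟩
  have hzb : ∀ a b c : V, ∃ L : ℤ, ∀ m n, m < L → th V (fun m n => Y b (Y a c n) m) m n = 0 := by
    intro a b c
    obtain ⟨K, hK⟩ := htr a c
    exact ⟨K, fun m n hm => by rw [th_apply, hK m hm, hz']⟩
  simp_rw [hsh, assoc_rhs (𝕜 := 𝕜) Y hlr, mulZW_eq]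
  constructor
  · intro h a b c
    obtain ⟨L, hL⟩ := hzb a b c
    refine ⟨(-L).toNat, ?_⟩
    rw [← sub_eq_zero, ← map_sub, ← kk_ce_pow _ L hL (-L).toNat (by omega)]
    congr 1
    ext m n
    exact h a b c m n
  · intro h a b c
    obtain ⟨l₁, h1⟩ := h a b c
    obtain ⟨l₂, h2⟩ := h b a c
    obtain ⟨M, hM⟩ := htr b a
    obtain ⟨M', hM'⟩ := htr a b
    obtain ⟨L, hL⟩ := hzb a b c
    obtain ⟨N, hN⟩ := locality _ _ _ _ (hyb a b c) (hyb b a c) M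
      (fun m n hm => by simp only [hM m hm, hz]) (skew_formal Y D hll htr htl hcm a b c)
      l₁ l₂ h1 h2
    have key : (fun m n => Y (Y a b m) c n) - sig (fun m n => Y a (Y b c n) m)
        - kk ce (th V (fun m n => Y b (Y a c n) m)) = 0 := by
      refine add_inj_zb _ (min M' (-N)) ?_ ((-L).toNat + l₁) ?_
      · intro m n hm
        have e := sig_Mn_row ((fun m n => Y a (Y b c n) m) - th V (fun m n => Y b (Y a c n) m))
          N (m + N) n (by omega)
        rw [hN, add_sub_cancel_right, sig_sub_neg _ _ _ _ (by omega)] at e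
        have e0 : sig (0 : ℤ → ℤ → V) (m + N) n = 0 := by
          refine Eq.trans (finsum_congr fun s => ?_) finsum_zero
          simp
        rw [e0] at e
        simp only [Pi.sub_apply]
        rw [hM' m (by omega), hz, kk_ce_neg _ _ _ (by omega), zero_sub, sub_neg_eq_add,
          neg_add_eq_sub, ← neg_sub, ← e, neg_zero]
      · rw [map_sub, pow_add, Module.End.mul_apply, map_sub, h1, sub_self, map_zero,
          ← pow_add, add_comm (-L).toNat, pow_add, Module.End.mul_apply,
          kk_ce_pow _ L hL (-L).toNat (by omega), map_zero, sub_zero]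
    intro m n
    exact sub_eq_zero.mp (congrFun (congrFun key m) n)

end VertexCohomology
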